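/- Let z_k, z : ℝ → ℝ ∪ {+∞} be energies satisfying (z1)–(z3) such that z_k(a) → z(a) for every a ∈ ℝ (convergence in ℝ ∪ {+∞}). Set b_∞ := inf{b ∈ ℝ : z*(b) = +∞} (with b_∞ = +∞ if z* is everywhere finite), and let s := lim_{b → b_∞⁻} z*(b) ∈ (0, +∞], which equals the supremum of the finite values of z*. Since z* and each z_k* are strictly increasing on the sets where they take values in (0,∞), the inverse functions (z*)^{-1} and (z_k*)^{-1} are well defined on z*(ℝ) ∩ (0,∞) and z_k*(ℝ) ∩ (0,∞) respectively. Then for every compact set K ⊂ (0, s): K ⊂ z_k*(ℝ) for all sufficiently large k, and sup_{c ∈ K} |(z_k*)^{-1}(c) − (z*)^{-1}(c)| → 0 as k → ∞. -/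

import Mathlib

open MeasureTheory Filter Set Topology

noncomputable section

/-- Convexity for `EReal`-valued functions on `ℝ`. -/
def ConvexE (f : ℝ → EReal) : Prop :=
  ∀ x y t : ℝ, 0 < t → t < 1 →
    f (t * x + (1 - t) * y) ≤ (t : EReal) * f x + ((1 - t) : EReal) * f y

/-- Subdifferential of an `EReal`-valued function at a point. -/
def subdiff (f : ℝ → EReal) (a : ℝ) : Set ℝ :=
  {b : ℝ | ∀ x : ℝ, f a + ((b * (x - a) : ℝ) : EReal) ≤ f x}

/-- Convex (Legendre) conjugate. -/
noncomputable def conj (f : ℝ → EReal) (b : ℝ) : EReal :=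
  ⨆ a : ℝ, ((a * b : ℝ) : EReal) - f a

/-- An energy satisfying assumptions (z1)-(z3). -/
structure IsEnergy (z : ℝ → EReal) : Prop where
  proper : ∃ a : ℝ, z a ≠ ⊤
  ne_bot : ∀ a : ℝ, z a ≠ ⊥
  lsc : LowerSemicontinuous z
  convex : ConvexE z
  top_of_neg : ∀ a : ℝ, a < 0 → z a = ⊤
  zero : z 0 = 0
  slope : ∃ a : ℝ, 0 < a ∧ ∃ L : ℝ, subdiff z a = {L} ∧ ∀ c ∈ subdiff z 0, c < L

theorem aux_conv {z : ℝ → EReal} (hz : IsEnergy z) {x y u v t : ℝ}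
    (hx : z x ≤ (u : EReal)) (hy : z y ≤ (v : EReal)) (h0 : 0 ≤ t) (h1 : t ≤ 1) :
    z (t * x + (1 - t) * y) ≤ ((t * u + (1 - t) * v : ℝ) : EReal) := by
  rcases h0.eq_or_lt with h0 | h0
  · subst h0; simpa using hy
  rcases h1.eq_or_lt with h1 | h1
  · subst h1; simpa using hx
  refine (hz.convex x y t h0 h1).trans ?_
  have e : (1 : EReal) - (t : EReal) = ((1 - t : ℝ) : EReal) := by norm_cast
  rw [e, EReal.coe_add, EReal.coe_mul, EReal.coe_mul]
  have ht : (0 : EReal) ≤ (t : EReal) := by exact_mod_cast h0.le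
  have ht' : (0 : EReal) ≤ ((1 - t : ℝ) : EReal) := by
    exact_mod_cast (by linarith : (0 : ℝ) ≤ 1 - t)
  exact add_le_add (mul_le_mul_of_nonneg_left hx ht) (mul_le_mul_of_nonneg_left hy ht')

theorem aux_conj_le {z : ℝ → EReal} {b M : ℝ} :
    conj z b ≤ (M : EReal) ↔ ∀ a u : ℝ, z a ≤ (u : EReal) → a * b - u ≤ M := by
  unfold conj
  rw [iSup_le_iff]
  refine forall_congr' fun a => ?_
  induction hza : z a using EReal.rec with
  | bot =>
    constructor
    · intro h
      rw [EReal.coe_sub_bot] at h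
      simp at h
    · intro h
      have := h (a * b - M - 1) bot_le
      linarith
  | top =>
    simp
  | coe r =>
    constructor
    · intro h u hu
      have h' : a * b - r ≤ M := by exact_mod_cast h
      have hu' : r ≤ u := by exact_mod_cast hu
      linarith
    · intro h
      have := h r le_rfl
      exact_mod_cast this

theorem aux_nonneg {z : ℝ → EReal} (hz : IsEnergy z) {a u : ℝ} (h : z a ≤ (u : EReal)) :
    0 ≤ a := by
  by_contra hc
  push Not at hc
  rw [hz.top_of_neg a hc] at h
  simp at h

theorem aux_zero {z : ℝ → EReal} (hz : IsEnergy z) : z 0 ≤ ((0 : ℝ) : EReal) := by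
  rw [hz.zero]; simp

theorem aux_M_nonneg {z : ℝ → EReal} (hz : IsEnergy z) {b M : ℝ}
    (h : conj z b ≤ (M : EReal)) : 0 ≤ M := by
  have := aux_conj_le.1 h 0 0 (aux_zero hz)
  simpa using this

theorem aux_mono {z : ℝ → EReal} (hz : IsEnergy z) {b b' M : ℝ} (hb : b ≤ b')
    (h : conj z b' ≤ (M : EReal)) : conj z b ≤ (M : EReal) := by
  rw [aux_conj_le] at h ⊢
  intro a u hu
  have := h a u hu
  have h2 := mul_le_mul_of_nonneg_left hb (aux_nonneg hz hu)
  linarith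

theorem aux_conj_convex {z : ℝ → EReal} {b b' M M' t : ℝ} (h0 : 0 ≤ t) (h1 : t ≤ 1)
    (h : conj z b ≤ (M : EReal)) (h' : conj z b' ≤ (M' : EReal)) :
    conj z (t * b + (1 - t) * b') ≤ ((t * M + (1 - t) * M' : ℝ) : EReal) := by
  rw [aux_conj_le] at h h' ⊢
  intro a u hu
  have e1 := mul_le_mul_of_nonneg_left (h a u hu) h0
  have e2 := mul_le_mul_of_nonneg_left (h' a u hu) (sub_nonneg.2 h1)
  linarith

theorem aux_small {z : ℝ → EReal} (hz : IsEnergy z) {η : ℝ} (hη : 0 < η) :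
    ∃ b : ℝ, conj z b ≤ (η : EReal) := by
  have h1 : ((-η : ℝ) : EReal) < z 0 := by
    rw [hz.zero]; exact_mod_cast (by linarith : -η < (0 : ℝ))
  have h2 := hz.lsc 0 _ h1
  obtain ⟨δ, hδ, hball⟩ := Metric.eventually_nhds_iff.1 h2
  refine ⟨-(2 * η / δ), aux_conj_le.2 fun a u hu => ?_⟩
  have ha := aux_nonneg hz hu
  have hp : 0 < 2 * η / δ := by positivity
  rcases lt_or_ge a δ with had | had
  · have h3 : ((-η : ℝ) : EReal) < z a := hball (by
      rw [Real.dist_eq, sub_zero, abs_of_nonneg ha]; exact had)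
    have h4 : -η < u := by exact_mod_cast h3.trans_le hu
    have := mul_nonneg ha hp.le
    linarith
  · have hapos : 0 < a := by linarith
    have h3 : ((-η : ℝ) : EReal) < z (δ / 2) := hball (by
      rw [Real.dist_eq, sub_zero, abs_of_nonneg (by positivity)]; linarith)
    have h5 := aux_conv hz hu (aux_zero hz) (t := δ / 2 / a) (by positivity)
      (by rw [div_le_one hapos]; linarith)
    have e : δ / 2 / a * a + (1 - δ / 2 / a) * 0 = δ / 2 := by field_simp; ring
    rw [e] at h5
    have h6 : -η < δ / 2 / a * u + (1 - δ / 2 / a) * 0 := by exact_mod_cast h3.trans_le h5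
    have h7 : -η * (2 * a / δ) < (δ / 2 / a * u + (1 - δ / 2 / a) * 0) * (2 * a / δ) :=
      mul_lt_mul_of_pos_right h6 (by positivity)
    have e2 : (δ / 2 / a * u + (1 - δ / 2 / a) * 0) * (2 * a / δ) = u := by
      field_simp; ring
    have e3 : -η * (2 * a / δ) = a * -(2 * η / δ) := by field_simp
    rw [e2, e3] at h7
    linarith

theorem aux_strict {z : ℝ → EReal} (hz : IsEnergy z) {b b' c : ℝ} (hc : 0 < c) (hb : b < b')
    (h : conj z b = (c : EReal)) : (c : EReal) < conj z b' := by
  by_contra hcon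
  push Not at hcon
  obtain ⟨b1, hb1⟩ := aux_small hz (half_pos hc)
  have hlt : b1 < b := by
    by_contra hh
    push Not at hh
    have := aux_mono hz hh hb1
    rw [h] at this
    have : c ≤ c / 2 := by exact_mod_cast this
    linarith
  have hd : 0 < b' - b1 := by linarith
  have ht : 0 < (b' - b) / (b' - b1) := div_pos (by linarith) hd
  have := aux_conj_convex (t := (b' - b) / (b' - b1)) ht.le
    (by rw [div_le_one hd]; linarith) hb1 hcon
  have e : (b' - b) / (b' - b1) * b1 + (1 - (b' - b) / (b' - b1)) * b' = b := by
    field_simp; ring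
  rw [e, h] at this
  have h2 : c ≤ (b' - b) / (b' - b1) * (c / 2) + (1 - (b' - b) / (b' - b1)) * c := by
    exact_mod_cast this
  nlinarith [mul_pos ht hc]

theorem aux_strict_left {z : ℝ → EReal} (hz : IsEnergy z) {b b' c : ℝ} (hc : 0 < c) (hb : b' < b)
    (h : conj z b = (c : EReal)) : conj z b' < (c : EReal) := by
  have h1 := aux_mono hz hb.le h.le
  refine lt_of_le_of_ne h1 fun h2 => ?_
  have := aux_strict hz hc hb h2
  rw [h] at this
  exact lt_irrefl _ this

theorem aux_exists {z : ℝ → EReal} (hz : IsEnergy z) {b2 c M : ℝ} (hc : 0 < c)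
    (h1 : (c : EReal) < conj z b2) (h2 : conj z b2 ≤ (M : EReal)) :
    ∃ b : ℝ, b < b2 ∧ conj z b = (c : EReal) := by
  set S : Set ℝ := {b | conj z b ≤ (c : EReal)} with hS
  have hub : ∀ b ∈ S, b ≤ b2 := by
    intro b hb
    by_contra hh
    push Not at hh
    exact absurd (aux_mono hz hh.le hb) (not_le.2 h1)
  have hbdd : BddAbove S := ⟨b2, hub⟩
  have hne : S.Nonempty := aux_small hz hc
  have hle : conj z (sSup S) ≤ (c : EReal) := by
    refine aux_conj_le.2 fun a u hu => ?_
    have ha := aux_nonneg hz hu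
    rcases ha.eq_or_lt with ha | ha
    · obtain ⟨b, hb⟩ := hne
      have := aux_conj_le.1 hb a u hu
      rw [← ha] at this ⊢
      linarith
    · have : sSup S ≤ (c + u) / a := csSup_le hne fun b hb => by
        have := aux_conj_le.1 hb a u hu
        rw [le_div_iff₀ ha]; linarith
      rw [le_div_iff₀ ha] at this
      linarith
  have hlt : sSup S < b2 := by
    refine lt_of_le_of_ne (csSup_le hne hub) fun h => ?_
    rw [h] at hle
    exact absurd hle (not_le.2 h1)
  refine ⟨sSup S, hlt, le_antisymm hle ?_⟩
  by_contra hh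
  push Not at hh
  obtain ⟨m, hm1, hm2⟩ := EReal.lt_iff_exists_real_btwn.1 hh
  have hm2 : m < c := by exact_mod_cast hm2
  have hcM : c < M := by exact_mod_cast h1.trans_le h2
  have hd : 0 < M - m := by linarith
  have ht : 0 < (c - m) / (M - m) := div_pos (by linarith) hd
  have := aux_conj_convex (t := (c - m) / (M - m)) ht.le
    (by rw [div_le_one hd]; linarith) h2 hm1.le
  have e : (c - m) / (M - m) * M + (1 - (c - m) / (M - m)) * m = c := by
    field_simp; ring
  rw [e] at this
  have h5 := le_csSup hbdd this
  nlinarith [mul_pos ht (sub_pos.2 hlt)]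

theorem aux_liminf {z : ℝ → EReal} {zk : ℕ → ℝ → EReal}
    (hconv : ∀ a : ℝ, Tendsto (fun k => zk k a) atTop (𝓝 (z a))) {b M : ℝ}
    (h : (M : EReal) < conj z b) : ∀ᶠ k in atTop, (M : EReal) < conj (zk k) b := by
  have h' := not_le.2 h
  rw [aux_conj_le] at h'
  push Not at h'
  obtain ⟨a, u, hu, hM⟩ := h'
  have h1 : z a < ((a * b - M : ℝ) : EReal) :=
    hu.trans_lt (by exact_mod_cast (by linarith : u < a * b - M))
  obtain ⟨m, hm1, hm2⟩ := EReal.lt_iff_exists_real_btwn.1 h1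
  have hm2 : m < a * b - M := by exact_mod_cast hm2
  filter_upwards [(hconv a).eventually_lt_const hm1] with k hk
  rw [← not_le, aux_conj_le]
  intro h3
  have := h3 a m hk.le
  linarith

theorem aux_local {z : ℝ → EReal} {zk : ℕ → ℝ → EReal}
    (hzk : ∀ k, IsEnergy (zk k))
    (hconv : ∀ a : ℝ, Tendsto (fun k => zk k a) atTop (𝓝 (z a))) {b M η x p C : ℝ}
    (hη : 0 < η) (hlow : ∀ q, 0 ≤ q → ((q * b - M : ℝ) : EReal) ≤ z q)
    (hx : 0 ≤ x) (hp : 0 ≤ p) (hpx : p ≠ x) (hC : z p ≤ (C : EReal)) :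
    ∃ U ∈ 𝓝 x, ∀ᶠ k in atTop, ∀ a ∈ U, ∀ u : ℝ, zk k a ≤ (u : EReal) → a * b - u ≤ M + η := by
  set D : ℝ := |C + 1 - p * b + M + η| + 1 with hD
  have hDpos : 0 < D := by positivity
  have hD1 : C + 1 - p * b + M + η ≤ D := by
    have := le_abs_self (C + 1 - p * b + M + η); linarith
  set θ : ℝ := min (1 / 2) (η / (4 * D)) with hθ
  have hθ0 : 0 < θ := by positivity
  have hθ1 : θ ≤ 1 / 2 := min_le_left _ _
  have hθ2 : θ * (4 * D) ≤ η := by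
    rw [← le_div_iff₀ (by positivity)]; exact min_le_right _ _
  set q : ℝ := x + θ * (p - x) with hq
  have hq0 : 0 ≤ q := by
    have : q = (1 - θ) * x + θ * p := by rw [hq]; ring
    rw [this]
    have : 0 ≤ 1 - θ := by linarith
    positivity
  have hcont : ContinuousAt (fun a : ℝ => (q - a) / (p - a)) x := by
    apply ContinuousAt.div (by fun_prop) (by fun_prop)
    exact sub_ne_zero.2 hpx
  have hval : (q - x) / (p - x) = θ := by
    rw [hq, div_eq_iff (sub_ne_zero.2 hpx)]; ring
  have hT : Tendsto (fun a : ℝ => (q - a) / (p - a)) (𝓝 x) (𝓝 θ) := by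
    have := hcont.tendsto
    rwa [hval] at this
  have hne : ∀ᶠ a in 𝓝 x, a ≠ p := eventually_ne_nhds hpx.symm
  refine ⟨_, ((hT.eventually_const_lt hθ0).and
    ((hT.eventually_lt_const (by linarith : θ < 2 * θ)).and hne)), ?_⟩
  have hl : ((q * b - M - η / 2 : ℝ) : EReal) < z q :=
    lt_of_lt_of_le (by exact_mod_cast (by linarith : q * b - M - η / 2 < q * b - M)) (hlow q hq0)
  have hu : z p < ((C + 1 : ℝ) : EReal) :=
    hC.trans_lt (by exact_mod_cast (by linarith : C < C + 1))
  filter_upwards [(hconv q).eventually_const_lt hl, (hconv p).eventually_lt_const hu] with k hk1 hk2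
  rintro a ⟨ht0, ht1, hap⟩ u hau
  generalize htt : (q - a) / (p - a) = t at ht0 ht1
  have e : t * p + (1 - t) * a = q := by
    rw [div_eq_iff (sub_ne_zero.2 hap.symm)] at htt
    linarith
  have h1 := aux_conv (hzk k) hk2.le hau ht0.le (by linarith)
  rw [e] at h1
  have h2 : q * b - M - η / 2 < t * (C + 1) + (1 - t) * u := by exact_mod_cast hk1.trans_le h1
  by_contra hcon
  push Not at hcon
  have h3 : (1 - t) * u ≤ (1 - t) * (a * b - (M + η)) :=
    mul_le_mul_of_nonneg_left (by linarith) (by linarith)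
  have h4 : t * (C + 1 - p * b + M + η) ≤ t * D := mul_le_mul_of_nonneg_left hD1 ht0.le
  have h5 : t * D ≤ 2 * θ * D := mul_le_mul_of_nonneg_right ht1.le hDpos.le
  rw [← e] at h2
  nlinarith

theorem aux_dom {z : ℝ → EReal} (hz : IsEnergy z) : ∃ a C : ℝ, 0 < a ∧ z a ≤ (C : EReal) := by
  obtain ⟨a, ha, L, hL, -⟩ := hz.slope
  have h1 : L ∈ subdiff z a := by rw [hL]; rfl
  have h2 := h1 0
  rw [hz.zero] at h2
  induction hza : z a using EReal.rec with
  | bot => exact absurd hza (hz.ne_bot a)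
  | top => rw [hza, EReal.top_add_coe] at h2; simp at h2
  | coe r => exact ⟨a, r, ha, hza.le⟩

theorem aux_limsup {z : ℝ → EReal} {zk : ℕ → ℝ → EReal} (hz : IsEnergy z)
    (hzk : ∀ k, IsEnergy (zk k))
    (hconv : ∀ a : ℝ, Tendsto (fun k => zk k a) atTop (𝓝 (z a))) {b b' M η : ℝ}
    (hη : 0 < η) (hb : b < b') (h : conj z b' ≤ (M : EReal)) :
    ∀ᶠ k in atTop, conj (zk k) b ≤ ((M + η : ℝ) : EReal) := by
  have hM := aux_M_nonneg hz h
  have hlow : ∀ b, conj z b ≤ (M : EReal) → ∀ q, 0 ≤ q → ((q * b - M : ℝ) : EReal) ≤ z q := by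
    intro b hb q hq
    by_contra hh
    push Not at hh
    obtain ⟨m, hm1, hm2⟩ := EReal.lt_iff_exists_real_btwn.1 hh
    have hm2 : m < q * b - M := by exact_mod_cast hm2
    have := aux_conj_le.1 hb q m hm1.le
    linarith
  have hd : 0 < b' - b := by linarith
  set R : ℝ := (M + 1) / (b' - b) with hR
  have hRpos : 0 < R := by positivity
  have hRe : R * (b' - b) = M + 1 := by rw [hR]; field_simp
  obtain ⟨p, C, hp, hC⟩ := aux_dom hz
  have hmid : ∀ᶠ k in atTop, ∀ a ∈ Icc 0 R, ∀ u : ℝ, zk k a ≤ (u : EReal) →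
      a * b - u ≤ M + η := by
    refine IsCompact.induction_on (p := fun S : Set ℝ => ∀ᶠ k in atTop, ∀ a ∈ S, ∀ u : ℝ,
      zk k a ≤ (u : EReal) → a * b - u ≤ M + η) isCompact_Icc ?_ ?_ ?_ ?_
    · simp
    · intro s t hst ht
      filter_upwards [ht] with k hk a ha using hk a (hst ha)
    · intro s t hs ht
      filter_upwards [hs, ht] with k hk1 hk2 a ha
      exact ha.elim (hk1 a) (hk2 a)
    · intro x hx
      have hl := hlow b (aux_mono hz hb.le h)
      rcases hx.1.eq_or_lt with hx0 | hx0
      · obtain ⟨U, hU, hU2⟩ := aux_local hzk hconv hη hl hx.1 hp.le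
          (by rw [← hx0]; exact hp.ne') hC
        exact ⟨U, mem_nhdsWithin_of_mem_nhds hU, hU2⟩
      · obtain ⟨U, hU, hU2⟩ := aux_local hzk hconv hη hl hx.1 le_rfl hx0.ne (aux_zero hz)
        exact ⟨U, mem_nhdsWithin_of_mem_nhds hU, hU2⟩
  have hlR : ((R * b' - M - 1 : ℝ) : EReal) < z R :=
    lt_of_lt_of_le (by exact_mod_cast (by linarith : R * b' - M - 1 < R * b' - M))
      (hlow b' h R hRpos.le)
  filter_upwards [hmid, (hconv R).eventually_const_lt hlR] with k hk1 hk2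
  refine aux_conj_le.2 fun a u hu => ?_
  rcases le_total a R with haR | haR
  · exact hk1 a ⟨aux_nonneg (hzk k) hu, haR⟩ u hu
  · have ha : 0 < a := by linarith
    have h5 := aux_conv (hzk k) hu (aux_zero (hzk k)) (t := R / a) (by positivity)
      (by rw [div_le_one ha]; linarith)
    have e : R / a * a + (1 - R / a) * 0 = R := by field_simp; ring
    rw [e] at h5
    have h6 : R * b' - M - 1 < R / a * u + (1 - R / a) * 0 := by exact_mod_cast hk2.trans_le h5
    have e1 : R * b' - M - 1 = R * b := by linarith
    have e2 : R / a * u + (1 - R / a) * 0 = R * (u / a) := by ring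
    rw [e1, e2] at h6
    have h7 := lt_of_mul_lt_mul_left h6 hRpos.le
    rw [lt_div_iff₀ ha] at h7
    linarith

theorem aux_close {z : ℝ → EReal} {zk : ℕ → ℝ → EReal} (hz : IsEnergy z)
    (hzk : ∀ k, IsEnergy (zk k))
    (hconv : ∀ a : ℝ, Tendsto (fun k => zk k a) atTop (𝓝 (z a))) {b0 c0 ε : ℝ}
    (hε : 0 < ε) (hc0 : 0 < c0) (h : conj z b0 = (c0 : EReal)) :
    ∃ U ∈ 𝓝 c0, ∀ᶠ k in atTop, ∀ c ∈ U, ∀ b : ℝ, conj (zk k) b = (c : EReal) →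
      |b - b0| ≤ ε := by
  have h1 := aux_strict hz hc0 (by linarith : b0 < b0 + ε) h
  have h2 := aux_strict_left hz hc0 (by linarith : b0 - ε / 2 < b0) h
  obtain ⟨m, hm1, hm2⟩ := EReal.lt_iff_exists_real_btwn.1 h1
  obtain ⟨n, hn1, hn2⟩ := EReal.lt_iff_exists_real_btwn.1 h2
  have hm1 : c0 < m := by exact_mod_cast hm1
  have hn2 : n < c0 := by exact_mod_cast hn2
  refine ⟨Ioo ((n + c0) / 2) m, Ioo_mem_nhds (by linarith) hm1, ?_⟩
  filter_upwards [aux_liminf hconv hm2, aux_limsup hz hzk hconv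
    (by linarith : 0 < (c0 - n) / 2) (by linarith : b0 - ε < b0 - ε / 2) hn1.le] with k hk1 hk2
  intro c hc b hb
  rw [abs_le]
  constructor
  · by_contra hh
    push Not at hh
    have := aux_mono (hzk k) (by linarith : b ≤ b0 - ε) hk2
    rw [hb] at this
    have : c ≤ n + (c0 - n) / 2 := by exact_mod_cast this
    linarith [hc.1]
  · by_contra hh
    push Not at hh
    have := aux_mono (hzk k) (by linarith : b0 + ε ≤ b) hb.le
    have : m < c := by exact_mod_cast hk1.trans_le this
    linarith [hc.2]

/-- If the energies `z_k → z` pointwise (all satisfying (z1)-(z3)), `s` denotes the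
supremum of the finite values of `z*`, then on every compact `K ⊂ (0, s)` the inverse
functions `(z_k*)⁻¹` are eventually defined on `K` and converge uniformly to `(z*)⁻¹`. -/
theorem statement18 (z : ℝ → EReal) (zk : ℕ → ℝ → EReal)
    (hz : IsEnergy z) (hzk : ∀ k, IsEnergy (zk k))
    (hconv : ∀ a : ℝ, Tendsto (fun k => zk k a) atTop (𝓝 (z a)))
    (s : EReal) (hs : s = sSup {x : EReal | ∃ b : ℝ, conj z b = x ∧ x ≠ ⊤}) :
    ∀ K : Set ℝ, IsCompact K → (∀ c ∈ K, 0 < c ∧ (c : EReal) < s) →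
      ∀ ε : ℝ, 0 < ε → ∃ N : ℕ, ∀ k ≥ N, ∀ c ∈ K,
        (∃ b : ℝ, conj (zk k) b = (c : EReal)) ∧
        (∃ b' : ℝ, conj z b' = (c : EReal)) ∧
        (∀ b b' : ℝ, conj (zk k) b = (c : EReal) → conj z b' = (c : EReal) →
          |b - b'| ≤ ε) := by
  intro K hK hKs ε hε
  suffices H : ∀ᶠ k in atTop, ∀ c ∈ K,
        (∃ b : ℝ, conj (zk k) b = (c : EReal)) ∧
        (∃ b' : ℝ, conj z b' = (c : EReal)) ∧
        (∀ b b' : ℝ, conj (zk k) b = (c : EReal) → conj z b' = (c : EReal) →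
          |b - b'| ≤ ε) from eventually_atTop.1 H
  have hex : ∀ c : ℝ, 0 < c → (c : EReal) < s → ∃ b3 b2 M : ℝ, b3 < b2 ∧
      (c : EReal) < conj z b3 ∧ conj z b2 ≤ (M : EReal) := by
    intro c hc hcs
    rw [hs, lt_sSup_iff] at hcs
    obtain ⟨x, ⟨b2, hb2, hx⟩, hcx⟩ := hcs
    obtain ⟨M, hM, -⟩ := EReal.lt_iff_exists_real_btwn.1 (lt_top_iff_ne_top.2 hx)
    rw [← hb2] at hM hcx
    obtain ⟨b, hb, hbc⟩ := aux_exists hz hc hcx hM.le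
    exact ⟨(b + b2) / 2, b2, M, by linarith, aux_strict hz hc (by linarith) hbc, hM.le⟩
  refine IsCompact.induction_on (p := fun S : Set ℝ => ∀ᶠ k in atTop, ∀ c ∈ S,
        (∃ b : ℝ, conj (zk k) b = (c : EReal)) ∧
        (∃ b' : ℝ, conj z b' = (c : EReal)) ∧
        (∀ b b' : ℝ, conj (zk k) b = (c : EReal) → conj z b' = (c : EReal) →
          |b - b'| ≤ ε)) hK ?_ ?_ ?_ ?_
  · simp
  · intro s t hst ht
    filter_upwards [ht] with k hk a ha using hk a (hst ha)
  · intro s t hs ht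
    filter_upwards [hs, ht] with k hk1 hk2 a ha
    exact ha.elim (hk1 a) (hk2 a)
  · intro c0 hc0
    obtain ⟨hc0p, hc0s⟩ := hKs c0 hc0
    obtain ⟨b3, b2, M, hb, h3, h2⟩ := hex c0 hc0p hc0s
    have h3' : conj z b3 ≤ (M : EReal) := aux_mono hz hb.le h2
    obtain ⟨b0, -, hb0⟩ := aux_exists hz hc0p h3 h3'
    obtain ⟨m, hm1, hm2⟩ := EReal.lt_iff_exists_real_btwn.1 h3
    have hm1 : c0 < m := by exact_mod_cast hm1
    obtain ⟨U, hU, hU2⟩ := aux_close hz hzk hconv (half_pos hε) hc0p hb0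
    obtain ⟨V, hV, hV2⟩ := aux_close (zk := fun _ => z) hz (fun _ => hz)
      (fun a => tendsto_const_nhds) (half_pos hε) hc0p hb0
    obtain ⟨_, hV2⟩ := hV2.exists
    refine ⟨(U ∩ V) ∩ Ioo 0 m, mem_nhdsWithin_of_mem_nhds
      (inter_mem (inter_mem hU hV) (Ioo_mem_nhds hc0p hm1)), ?_⟩
    filter_upwards [hU2, aux_liminf hconv hm2, aux_limsup hz hzk hconv one_pos hb h2]
      with k hk1 hk2 hk3
    rintro c ⟨⟨hcU, hcV⟩, hc1, hc2⟩
    have hcm : (c : EReal) < (m : EReal) := by exact_mod_cast hc2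
    obtain ⟨b, -, hbk⟩ := aux_exists (hzk k) hc1 (hcm.trans hk2) hk3
    obtain ⟨b', -, hbz⟩ := aux_exists hz hc1 (hcm.trans hm2) h3'
    refine ⟨⟨b, hbk⟩, ⟨b', hbz⟩, fun b b' h h' => ?_⟩
    have e1 := abs_le.1 (hk1 c hcU b h)
    have e2 := abs_le.1 (hV2 c hcV b' h')
    rw [abs_le]
    constructor <;> linarith [e1.1, e1.2, e2.1, e2.2]
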